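/- arXiv:2101.12564 — 2 statements merged into one kernel-verified Lean document; each statement's English description precedes it below -/
import Mathlib

section
/- (Coding theorem, achievability) For every γ ≥ 0 and α ∈ (0,1), the pair (γ, \bar I_{α,M}(γ)) is an achievable Rényi entropy-relevance pair: there exists a sequence of codes Φⁿ_{α,M} : 𝒳ⁿ → 𝒲ⁿ such that limsup_n (1/n) Σ_{i=1}^n H_α(W_i) ≤ γ and liminf_n (1/n) Σ_{i=1}^n I(Y_i;W_i) ≥ \bar I_{α,M}(γ), where (Y_i, X_i) are i.i.d. with law P_{Y,X} and Wⁿ = Φⁿ_{α,M}(Xⁿ). Moreover, this is achieved by time-sharing between two symbol-wise randomized mappings. -/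
open Real BigOperators Filter

noncomputable section

/-- Base-2 Shannon entropy of a probability vector on a finite alphabet. -/
def shEnt {I : Type} [Fintype I] (P : I → ℝ) : ℝ := -∑ i, P i * Real.logb 2 (P i)

/-- Rényi entropy of order `α` (base 2) of a probability vector. -/
def renyiEnt {I : Type} [Fintype I] (α : ℝ) (P : I → ℝ) : ℝ :=
  (1 - α)⁻¹ * Real.logb 2 (∑ i, P i ^ α)

open Classical in
/-- Entropy of order `α`, where `α = 1` is understood as Shannon entropy. -/
def entOrd {I : Type} [Fintype I] (α : ℝ) (P : I → ℝ) : ℝ :=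
  if α = 1 then shEnt P else renyiEnt α P

/-- `p` is a joint pmf on `Y × X`. -/
def IsJointPmf {Y X : Type} [Fintype Y] [Fintype X] (p : Y → X → ℝ) : Prop :=
  (∀ y x, 0 ≤ p y x) ∧ ∑ y, ∑ x, p y x = 1

/-- `q` is a channel (conditional pmf) from `X` to `W`. -/
def IsKernel {X W : Type} [Fintype X] [Fintype W] (q : X → W → ℝ) : Prop :=
  (∀ x w, 0 ≤ q x w) ∧ ∀ x, ∑ w, q x w = 1

def margX {Y X : Type} [Fintype Y] [Fintype X] (p : Y → X → ℝ) (x : X) : ℝ := ∑ y, p y x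

def margY {Y X : Type} [Fintype Y] [Fintype X] (p : Y → X → ℝ) (y : Y) : ℝ := ∑ x, p y x

/-- Marginal of `W` when `W` is generated from `X` through the channel `q`. -/
def margW {Y X W : Type} [Fintype Y] [Fintype X] [Fintype W]
    (p : Y → X → ℝ) (q : X → W → ℝ) (w : W) : ℝ := ∑ x, margX p x * q x w

/-- Joint pmf of `(Y, W)` under the Markov chain `Y - X - W`. -/
def jointYW {Y X W : Type} [Fintype Y] [Fintype X] [Fintype W]
    (p : Y → X → ℝ) (q : X → W → ℝ) (y : Y) (w : W) : ℝ := ∑ x, p y x * q x w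

/-- Joint pmf of `(X, W)`. -/
def jointXW {Y X W : Type} [Fintype Y] [Fintype X] [Fintype W]
    (p : Y → X → ℝ) (q : X → W → ℝ) (x : X) (w : W) : ℝ := margX p x * q x w

/-- Mutual information (base 2) of a joint pmf on `A × B`. -/
def mi2 {A B : Type} [Fintype A] [Fintype B] (r : A → B → ℝ) : ℝ :=
  shEnt (fun a => ∑ b, r a b) + shEnt (fun b => ∑ a, r a b)
    - shEnt (fun ab : A × B => r ab.1 ab.2)

/-- `I(Y;W)` under the Markov chain `Y - X - W`. -/
def miYW {Y X W : Type} [Fintype Y] [Fintype X] [Fintype W]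
    (p : Y → X → ℝ) (q : X → W → ℝ) : ℝ := mi2 (jointYW p q)

/-- `I(Y;X)`. -/
def miYX {Y X : Type} [Fintype Y] [Fintype X] (p : Y → X → ℝ) : ℝ := mi2 p

/-- `I(X;W)`. -/
def miXW {Y X W : Type} [Fintype Y] [Fintype X] [Fintype W]
    (p : Y → X → ℝ) (q : X → W → ℝ) : ℝ := mi2 (jointXW p q)

/-- The bottleneck function `F_{α,M}(γ)`: maximal relevance `I(Y;W)` over channels
`P_{W|X}` with output alphabet of size (at most) `M` satisfying `H_α(W) ≤ γ`. -/
def Ffun {Y X : Type} [Fintype Y] [Fintype X] (p : Y → X → ℝ) (M : ℕ) (α γ : ℝ) : ℝ :=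
  sSup {v | ∃ q : X → Fin M → ℝ, IsKernel q ∧ entOrd α (margW p q) ≤ γ ∧ v = miYW p q}

/-- Upper concave envelope on `[0,∞)` via two-point convex combinations. -/
def env (F : ℝ → ℝ) (γ : ℝ) : ℝ :=
  sSup {v | ∃ t γ₁ γ₂ : ℝ, 0 ≤ t ∧ t ≤ 1 ∧ 0 ≤ γ₁ ∧ 0 ≤ γ₂ ∧
    t * γ₁ + (1 - t) * γ₂ = γ ∧ v = t * F γ₁ + (1 - t) * F γ₂}

/-- The information bottleneck function `\bar I_IB(r)`. -/
def IBfun {Y X : Type} [Fintype Y] [Fintype X] (p : Y → X → ℝ) (r : ℝ) : ℝ :=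
  sSup {v | ∃ (m : ℕ) (q : X → Fin m → ℝ), IsKernel q ∧ miXW p q ≤ r ∧ v = miYW p q}

/-- The i.i.d. joint pmf of `(Yⁿ, Xⁿ)`. -/
def iidP {Y X : Type} [Fintype Y] [Fintype X] (p : Y → X → ℝ) (n : ℕ)
    (yn : Fin n → Y) (xn : Fin n → X) : ℝ := ∏ i, p (yn i) (xn i)

open Classical in
/-- Joint pmf of `(Y_i, W_i)` when `Wⁿ` is produced from `Xⁿ` by the (possibly randomized)
code `Q` and `(Yⁿ, Xⁿ)` is i.i.d. with per-letter law `p`. -/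
def pairYW {Y X W : Type} [Fintype Y] [Fintype X] [Fintype W]
    (p : Y → X → ℝ) (n : ℕ) (Q : (Fin n → X) → (Fin n → W) → ℝ) (i : Fin n)
    (y : Y) (w : W) : ℝ :=
  ∑ yn : Fin n → Y, ∑ xn : Fin n → X, ∑ wn : Fin n → W,
    iidP p n yn xn * Q xn wn * (if yn i = y ∧ wn i = w then 1 else 0)

/-- Average per-letter output Rényi entropy `γ_n = (1/n) ∑ H_α(W_i)` of a code. -/
def avgRenyi {Y X W : Type} [Fintype Y] [Fintype X] [Fintype W]
    (p : Y → X → ℝ) (n : ℕ) (Q : (Fin n → X) → (Fin n → W) → ℝ) (α : ℝ) : ℝ :=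
  (1 / (n : ℝ)) * ∑ i : Fin n, renyiEnt α (fun w => ∑ y, pairYW p n Q i y w)

/-- Average per-letter relevance `η_n = (1/n) ∑ I(Y_i; W_i)` of a code. -/
def avgRel {Y X W : Type} [Fintype Y] [Fintype X] [Fintype W]
    (p : Y → X → ℝ) (n : ℕ) (Q : (Fin n → X) → (Fin n → W) → ℝ) : ℝ :=
  (1 / (n : ℝ)) * ∑ i : Fin n, mi2 (pairYW p n Q i)

/-- A Rényi entropy-relevance pair `(γ, η)` is achievable if some sequence of
(possibly randomized) codes `Φⁿ : 𝒳ⁿ → 𝒲ⁿ`, `|𝒲| ≤ M`, has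
`limsup γ_n ≤ γ` and `liminf η_n ≥ η`. -/
def Achievable {Y X : Type} [Fintype Y] [Fintype X]
    (p : Y → X → ℝ) (M : ℕ) (α γ η : ℝ) : Prop :=
  ∃ Q : (n : ℕ) → (Fin n → X) → (Fin n → Fin M) → ℝ,
    (∀ n, IsKernel (Q n)) ∧
    Filter.limsup (fun n => avgRenyi p n (Q n) α) Filter.atTop ≤ γ ∧
    η ≤ Filter.liminf (fun n => avgRel p n (Q n)) Filter.atTop

/-- The achievable Rényi entropy-relevance region: the closure of all achievable pairs. -/
def Region {Y X : Type} [Fintype Y] [Fintype X]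
    (p : Y → X → ℝ) (M : ℕ) (α : ℝ) : Set (ℝ × ℝ) :=
  closure {z : ℝ × ℝ | 0 ≤ z.1 ∧ 0 ≤ z.2 ∧ Achievable p M α z.1 z.2}

/-- `I_{α,M}(γ)`: the maximal achievable relevance at Rényi entropy cost `γ`. -/
def Irel {Y X : Type} [Fintype Y] [Fintype X]
    (p : Y → X → ℝ) (M : ℕ) (α γ : ℝ) : ℝ :=
  sSup {η | (γ, η) ∈ Region p M α}

section Marginals

variable {Y X W : Type} [Fintype Y] [Fintype X] [Fintype W] {p : Y → X → ℝ} {q : X → W → ℝ}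

lemma margX_nonneg (hp : IsJointPmf p) (x : X) : 0 ≤ margX p x :=
  Finset.sum_nonneg fun y _ => hp.1 y x

lemma sum_margX (hp : IsJointPmf p) : ∑ x, margX p x = 1 := by
  rw [← hp.2]
  exact Finset.sum_comm

lemma margW_nonneg (hp : IsJointPmf p) (hq : IsKernel q) (w : W) : 0 ≤ margW p q w :=
  Finset.sum_nonneg fun x _ => mul_nonneg (margX_nonneg hp x) (hq.1 x w)

lemma sum_margW (hp : IsJointPmf p) (hq : IsKernel q) : ∑ w, margW p q w = 1 := by
  unfold margW
  rw [Finset.sum_comm]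
  simp_rw [← Finset.mul_sum, hq.2, mul_one]
  exact sum_margX hp

lemma sum_jointYW (w : W) : ∑ y, jointYW p q y w = margW p q w := by
  unfold jointYW margW margX
  rw [Finset.sum_comm]
  simp_rw [Finset.sum_mul]

end Marginals

/-- The power sum of order `α ≤ 1` of a probability vector is at least one. -/
lemma one_le_sum_rpow {I : Type} [Fintype I] {P : I → ℝ} {α : ℝ} (hα0 : 0 < α) (hα1 : α < 1)
    (hP : ∀ i, 0 ≤ P i) (hs : ∑ i, P i = 1) : 1 ≤ ∑ i, P i ^ α := by
  rw [← hs]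
  refine Finset.sum_le_sum fun i _ => ?_
  have h1 : P i ≤ 1 := hs ▸ Finset.single_le_sum (fun j _ => hP j) (Finset.mem_univ i)
  rcases (hP i).eq_or_lt with h0 | h0
  · simp [← h0, Real.zero_rpow hα0.ne']
  · simpa using Real.rpow_le_rpow_of_exponent_ge h0 h1 hα1.le

lemma continuous_shEnt {I : Type} [Fintype I] : Continuous (shEnt : (I → ℝ) → ℝ) := by
  have h : (shEnt : (I → ℝ) → ℝ) = fun P => ∑ i, Real.negMulLog (P i) / Real.log 2 := by
    funext P
    simp only [shEnt, Real.negMulLog, Real.logb, ← Finset.sum_neg_distrib]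
    exact Finset.sum_congr rfl fun i _ => by ring
  rw [h]
  fun_prop

lemma continuous_miYW {Y X W : Type} [Fintype Y] [Fintype X] [Fintype W] (p : Y → X → ℝ) :
    Continuous fun q : X → W → ℝ => miYW p q := by
  unfold miYW mi2 jointYW
  refine ((continuous_shEnt.comp ?_).add (continuous_shEnt.comp ?_)).sub
    (continuous_shEnt.comp ?_) <;> fun_prop

lemma continuousOn_renyiEnt_margW {Y X W : Type} [Fintype Y] [Fintype X] [Fintype W]
    {p : Y → X → ℝ} (hp : IsJointPmf p) {α : ℝ} (hα0 : 0 < α) (hα1 : α < 1) :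
    ContinuousOn (fun q : X → W → ℝ => renyiEnt α (margW p q)) {q | IsKernel q} := by
  unfold renyiEnt Real.logb
  refine continuousOn_const.mul (ContinuousOn.div_const (ContinuousOn.log ?_ ?_) _)
  · refine Continuous.continuousOn (continuous_finsetSum _ fun w _ => ?_)
    refine Continuous.rpow_const ?_ fun _ => Or.inr hα0.le
    unfold margW
    fun_prop
  · intro q hq
    have := one_le_sum_rpow hα0 hα1 (margW_nonneg hp hq) (sum_margW hp hq)
    positivity

lemma isCompact_isKernel {X W : Type} [Fintype X] [Fintype W] :
    IsCompact {q : X → W → ℝ | IsKernel q} := by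
  refine (isCompact_Icc (a := (0 : X → W → ℝ)) (b := 1)).of_isClosed_subset ?_ ?_
  · simp only [IsKernel, Set.ofPred_and, Set.ofPred_forall]
    refine IsClosed.inter ?_ ?_
    · exact isClosed_iInter fun x => isClosed_iInter fun w =>
        isClosed_le continuous_const (by fun_prop)
    · exact isClosed_iInter fun x => isClosed_eq (by fun_prop) continuous_const
  · intro q hq
    refine ⟨fun x w => hq.1 x w, fun x w => ?_⟩
    show q x w ≤ 1
    rw [← hq.2 x]
    exact Finset.single_le_sum (fun v _ => hq.1 x v) (Finset.mem_univ w)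

/-- A constant channel has zero output Rényi entropy. -/
lemma exists_isKernel_renyiEnt_eq_zero {Y X : Type} [Fintype Y] [Fintype X] {p : Y → X → ℝ}
    (hp : IsJointPmf p) {M : ℕ} (hM : 0 < M) {α : ℝ} (hα0 : 0 < α) :
    ∃ q : X → Fin M → ℝ, IsKernel q ∧ renyiEnt α (margW p q) = 0 := by
  refine ⟨fun _ w => if w = ⟨0, hM⟩ then 1 else 0, ⟨fun x w => ?_, fun x => by simp⟩, ?_⟩
  · dsimp only
    split_ifs <;> norm_num
  · have h (w : Fin M) : margW p (fun _ w => if w = (⟨0, hM⟩ : Fin M) then (1 : ℝ) else 0) w =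
        if w = ⟨0, hM⟩ then 1 else 0 := by
      unfold margW
      rw [← Finset.sum_mul, sum_margX hp, one_mul]
    have h' (w : Fin M) : (if w = (⟨0, hM⟩ : Fin M) then (1 : ℝ) else 0) ^ α =
        if w = ⟨0, hM⟩ then 1 else 0 := by
      split_ifs <;> simp [hα0.ne']
    simp [renyiEnt, h, h']

/-- The supremum defining the bottleneck function is attained. -/
lemma exists_isKernel_miYW_eq_Ffun {Y X : Type} [Fintype Y] [Fintype X] {p : Y → X → ℝ}
    (hp : IsJointPmf p) {M : ℕ} (hM : 0 < M) {α : ℝ} (hα0 : 0 < α) (hα1 : α < 1)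
    {γ : ℝ} (hγ : 0 ≤ γ) :
    ∃ q : X → Fin M → ℝ, IsKernel q ∧ renyiEnt α (margW p q) ≤ γ ∧ miYW p q = Ffun p M α γ := by
  have hK : IsCompact ({q : X → Fin M → ℝ | IsKernel q} ∩
      (fun q => renyiEnt α (margW p q)) ⁻¹' Set.Iic γ) :=
    isCompact_isKernel.of_isClosed_subset
      ((continuousOn_renyiEnt_margW hp hα0 hα1).preimage_isClosed_of_isClosed
        isCompact_isKernel.isClosed isClosed_Iic) Set.inter_subset_left
  obtain ⟨q₀, hq₀, h₀⟩ := exists_isKernel_renyiEnt_eq_zero hp hM hα0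
  obtain ⟨q, ⟨hq, hqγ⟩, hmax⟩ := hK.exists_isMaxOn ⟨q₀, hq₀, h₀.trans_le hγ⟩
    (continuous_miYW p).continuousOn
  refine ⟨q, hq, hqγ, Eq.symm (IsGreatest.csSup_eq ⟨⟨q, hq, ?_, rfl⟩, ?_⟩)⟩
  · simpa [entOrd, hα1.ne] using hqγ
  · rintro v ⟨r, hr, hrγ, rfl⟩
    exact hmax ⟨hr, by simpa [entOrd, hα1.ne] using hrγ⟩

/-- The concave envelope of the bottleneck function is dominated by a time-sharing pair of
channels that meets the entropy constraint. -/
lemma exists_isKernel_env_le {Y X : Type} [Fintype Y] [Fintype X] {p : Y → X → ℝ}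
    (hp : IsJointPmf p) {M : ℕ} (hM : 0 < M) {α : ℝ} (hα0 : 0 < α) (hα1 : α < 1)
    {γ : ℝ} (hγ : 0 ≤ γ) :
    ∃ (t : ℝ) (q₁ q₂ : X → Fin M → ℝ), 0 ≤ t ∧ t ≤ 1 ∧ IsKernel q₁ ∧ IsKernel q₂ ∧
      t * renyiEnt α (margW p q₁) + (1 - t) * renyiEnt α (margW p q₂) ≤ γ ∧
      env (Ffun p M α) γ ≤ t * miYW p q₁ + (1 - t) * miYW p q₂ := by
  set H : (X → Fin M → ℝ) → ℝ := fun q => renyiEnt α (margW p q)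
  set S : Set (ℝ × (X → Fin M → ℝ) × (X → Fin M → ℝ)) :=
    Set.Icc 0 1 ×ˢ {q | IsKernel q} ×ˢ {q | IsKernel q}
  have hS : IsCompact S := isCompact_Icc.prod (isCompact_isKernel.prod isCompact_isKernel)
  have hH : ContinuousOn H {q | IsKernel q} := continuousOn_renyiEnt_margW hp hα0 hα1
  have hcont : ContinuousOn (fun z : ℝ × (X → Fin M → ℝ) × (X → Fin M → ℝ) =>
      z.1 * H z.2.1 + (1 - z.1) * H z.2.2) S := by
    have h1 : ContinuousOn (fun z : ℝ × (X → Fin M → ℝ) × (X → Fin M → ℝ) => H z.2.1) S :=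
      hH.comp (by fun_prop) fun z hz => hz.2.1
    have h2 : ContinuousOn (fun z : ℝ × (X → Fin M → ℝ) × (X → Fin M → ℝ) => H z.2.2) S :=
      hH.comp (by fun_prop) fun z hz => hz.2.2
    exact (continuousOn_fst.mul h1).add ((continuousOn_const.sub continuousOn_fst).mul h2)
  have hK : IsCompact (S ∩ (fun z => z.1 * H z.2.1 + (1 - z.1) * H z.2.2) ⁻¹' Set.Iic γ) :=
    hS.of_isClosed_subset (hcont.preimage_isClosed_of_isClosed hS.isClosed isClosed_Iic)
      Set.inter_subset_left
  have hI : Continuous fun z : ℝ × (X → Fin M → ℝ) × (X → Fin M → ℝ) =>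
      z.1 * miYW p z.2.1 + (1 - z.1) * miYW p z.2.2 :=
    (continuous_fst.mul ((continuous_miYW p).comp (by fun_prop))).add
      ((continuous_const.sub continuous_fst).mul ((continuous_miYW p).comp (by fun_prop)))
  obtain ⟨q₀, hq₀, h₀⟩ := exists_isKernel_renyiEnt_eq_zero hp hM hα0
  obtain ⟨⟨t, q₁, q₂⟩, ⟨⟨ht, hq₁, hq₂⟩, hle⟩, hmax⟩ := hK.exists_isMaxOn
    ⟨(0, q₀, q₀), ⟨⟨by simp, hq₀, hq₀⟩, by simpa [H, h₀] using hγ⟩⟩ hI.continuousOn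
  refine ⟨t, q₁, q₂, ht.1, ht.2, hq₁, hq₂, hle, csSup_le ?_ ?_⟩
  · exact ⟨_, 1, γ, γ, zero_le_one, le_rfl, hγ, hγ, by ring, rfl⟩
  · rintro v ⟨s, γ₁, γ₂, hs0, hs1, hγ₁, hγ₂, hsγ, rfl⟩
    obtain ⟨r₁, hr₁, hrγ₁, hF₁⟩ := exists_isKernel_miYW_eq_Ffun hp hM hα0 hα1 hγ₁
    obtain ⟨r₂, hr₂, hrγ₂, hF₂⟩ := exists_isKernel_miYW_eq_Ffun hp hM hα0 hα1 hγ₂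
    rw [← hF₁, ← hF₂]
    refine hmax (a := (s, r₁, r₂)) ⟨⟨⟨hs0, hs1⟩, hr₁, hr₂⟩, ?_⟩
    show s * H r₁ + (1 - s) * H r₂ ≤ γ
    rw [← hsγ]
    exact add_le_add (mul_le_mul_of_nonneg_left hrγ₁ hs0)
      (mul_le_mul_of_nonneg_left hrγ₂ (sub_nonneg.2 hs1))

/-- A product of single-letter channels is a channel. -/
lemma isKernel_prod {X W : Type} [Fintype X] [Fintype W] {n : ℕ} {r : Fin n → X → W → ℝ}
    (hr : ∀ i, IsKernel (r i)) :
    IsKernel fun (xn : Fin n → X) (wn : Fin n → W) => ∏ i, r i (xn i) (wn i) := by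
  classical
  refine ⟨fun xn wn => Finset.prod_nonneg fun i _ => (hr i).1 _ _, fun xn => ?_⟩
  rw [← Fintype.prod_sum fun i w => r i (xn i) w]
  exact Finset.prod_eq_one fun i _ => (hr i).2 _

/-- Under a symbol-wise code, the `i`-th pair has the law induced by the `i`-th channel. -/
lemma pairYW_prod {Y X W : Type} [Fintype Y] [Fintype X] [Fintype W] {p : Y → X → ℝ}
    (hp : IsJointPmf p) {n : ℕ} {r : Fin n → X → W → ℝ} (hr : ∀ i, IsKernel (r i)) (i : Fin n) :
    pairYW p n (fun xn wn => ∏ k, r k (xn k) (wn k)) i = jointYW p (r i) := by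
  classical
  funext y w
  let f : Fin n → Y → X → W → ℝ := fun k a b c =>
    p a b * r k b c * if k = i then (if a = y ∧ c = w then 1 else 0) else 1
  have hf (yn : Fin n → Y) (xn : Fin n → X) (wn : Fin n → W) :
      iidP p n yn xn * (∏ k, r k (xn k) (wn k)) * (if yn i = y ∧ wn i = w then 1 else 0) =
        ∏ k, f k (yn k) (xn k) (wn k) := by
    simp only [f, iidP, Finset.prod_mul_distrib, Finset.prod_ite_eq', Finset.mem_univ, if_true]
  have hsum : pairYW p n (fun xn wn => ∏ k, r k (xn k) (wn k)) i y w =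
      ∏ k, ∑ a, ∑ b, ∑ c, f k a b c := by
    rw [Fintype.prod_sum fun k a => ∑ b, ∑ c, f k a b c]
    unfold pairYW
    refine Finset.sum_congr rfl fun yn _ => ?_
    rw [Fintype.prod_sum fun k b => ∑ c, f k (yn k) b c]
    refine Finset.sum_congr rfl fun xn _ => ?_
    rw [Fintype.prod_sum fun k c => f k (yn k) (xn k) c]
    refine Finset.sum_congr rfl fun wn _ => ?_
    rw [← hf]
  rw [hsum, Finset.prod_eq_single i]
  · simp only [f, if_true, jointYW]
    rw [Finset.sum_eq_single y]
    · refine Finset.sum_congr rfl fun b _ => ?_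
      rw [Finset.sum_eq_single w] <;> simp +contextual
    · intro a _ ha
      simp [ha]
    · simp
  · intro k _ hk
    simp only [f, hk, if_false, mul_one, ← Finset.mul_sum, (hr k).2]
    exact hp.2
  · simp

lemma sum_fin_ite_lt {m n : ℕ} (h : m ≤ n) (a b : ℝ) :
    ∑ i : Fin n, (if (i : ℕ) < m then a else b) = m * a + (n - m) * b := by
  rw [Fin.sum_univ_eq_sum_range (fun i => if i < m then a else b),
    ← Finset.sum_range_add_sum_Ico _ h, Finset.sum_congr rfl
      (fun i hi => if_pos (Finset.mem_range.1 hi)), Finset.sum_congr rfl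
      (fun i hi => if_neg (not_lt.2 (Finset.mem_Ico.1 hi).1))]
  simp [Nat.cast_sub h]

/-- Averages of a two-valued sequence that switches at `⌊t * n⌋` converge to the mixture. -/
lemma tendsto_avg_ite_lt_floor {t : ℝ} (ht0 : 0 ≤ t) (ht1 : t ≤ 1) (a b : ℝ) :
    Tendsto (fun n : ℕ => (1 / (n : ℝ)) * ∑ i : Fin n, (if (i : ℕ) < ⌊t * n⌋₊ then a else b))
      atTop (nhds (t * a + (1 - t) * b)) := by
  have hlim : Tendsto (fun n : ℕ => (⌊t * n⌋₊ : ℝ) / n) atTop (nhds t) :=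
    (tendsto_nat_floor_mul_div_atTop ht0).comp tendsto_natCast_atTop_atTop
  refine ((hlim.mul_const a).add ((hlim.const_sub 1).mul_const b)).congr' ?_
  filter_upwards [eventually_gt_atTop 0] with n hn
  have hle : ⌊t * n⌋₊ ≤ n :=
    Nat.floor_le_of_le (mul_le_of_le_one_left n.cast_nonneg ht1)
  rw [sum_fin_ite_lt hle]
  field_simp

/-- coding theorem, achievability: for every `γ ≥ 0` and `α ∈ (0,1)`,
the pair `(γ, \bar I_{α,M}(γ))` is achievable, and it is achieved by time-sharing
between two symbol-wise randomized mappings. -/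
theorem stmt11 {Y X : Type} [Fintype Y] [Fintype X]
    (p : Y → X → ℝ) (hp : IsJointPmf p)
    (M : ℕ) (hM : 0 < M) (α : ℝ) (hα0 : 0 < α) (hα1 : α < 1)
    (γ : ℝ) (hγ : 0 ≤ γ) :
    ∃ (q₁ q₂ : X → Fin M → ℝ) (m : ℕ → ℕ)
      (Q : (n : ℕ) → (Fin n → X) → (Fin n → Fin M) → ℝ),
      IsKernel q₁ ∧ IsKernel q₂ ∧ (∀ n, m n ≤ n) ∧
      (∀ (n : ℕ) (xn : Fin n → X) (wn : Fin n → Fin M),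
        Q n xn wn = ∏ i : Fin n,
          if (i : ℕ) < m n then q₁ (xn i) (wn i) else q₂ (xn i) (wn i)) ∧
      (∀ n, IsKernel (Q n)) ∧
      Filter.limsup (fun n => avgRenyi p n (Q n) α) Filter.atTop ≤ γ ∧
      env (Ffun p M α) γ ≤ Filter.liminf (fun n => avgRel p n (Q n)) Filter.atTop := by
  obtain ⟨t, q₁, q₂, ht0, ht1, hq₁, hq₂, hH, hI⟩ := exists_isKernel_env_le hp hM hα0 hα1 hγ
  let r : (n : ℕ) → Fin n → X → Fin M → ℝ := fun n i => if (i : ℕ) < ⌊t * n⌋₊ then q₁ else q₂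
  have hr (n : ℕ) (i : Fin n) : IsKernel (r n i) := by
    dsimp only [r]
    split_ifs
    exacts [hq₁, hq₂]
  refine ⟨q₁, q₂, fun n => ⌊t * n⌋₊, fun n xn wn => ∏ i, r n i (xn i) (wn i), hq₁, hq₂,
    fun n => Nat.floor_le_of_le (mul_le_of_le_one_left n.cast_nonneg ht1), fun n xn wn => ?_,
    fun n => isKernel_prod (hr n), ?_, ?_⟩
  · refine Finset.prod_congr rfl fun i _ => ?_
    dsimp only [r]
    split_ifs <;> rfl
  · refine le_of_eq_of_le (Tendsto.limsup_eq ?_) hH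
    refine (tendsto_avg_ite_lt_floor ht0 ht1 _ _).congr fun n => ?_
    simp only [avgRenyi, pairYW_prod hp (hr n), sum_jointYW]
    congr 1
    refine Finset.sum_congr rfl fun i _ => ?_
    dsimp only [r]
    split_ifs <;> rfl
  · refine le_of_le_of_eq hI (Eq.symm (Tendsto.liminf_eq ?_))
    refine (tendsto_avg_ite_lt_floor ht0 ht1 _ _).congr fun n => ?_
    simp only [avgRel, pairYW_prod hp (hr n)]
    congr 1
    refine Finset.sum_congr rfl fun i _ => ?_
    dsimp only [r]
    split_ifs <;> rfl

end
end

section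
/- (Example 1) Suppose Y = f(X) for a function f : 𝒳 → 𝒴, and let M be a finite integer with M ≥ |𝒳|. Then \bar I_{1,M}(γ) = Ω(γ) for all γ ≥ 0, where Ω(γ) = γ for γ ∈ [0, H(Y)] and Ω(γ) = H(Y) for γ > H(Y) (note I(Y;X) = H(Y) here). -/
open Real BigOperators Filter

noncomputable section

/-- The entropy of a nonnegative joint mass function is at least that of its first marginal. -/
lemma shEnt_fst_le {A B : Type} [Fintype A] [Fintype B] (r : A → B → ℝ)
    (hr : ∀ a b, 0 ≤ r a b) :
    shEnt (fun a => ∑ b, r a b) ≤ shEnt (fun ab : A × B => r ab.1 ab.2) := by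
  unfold shEnt
  rw [Fintype.sum_prod_type, neg_le_neg_iff]
  refine Finset.sum_le_sum fun a _ => ?_
  rw [Finset.sum_mul]
  refine Finset.sum_le_sum fun b _ => ?_
  rcases (hr a b).eq_or_lt with h | h
  · simp [← h]
  · exact mul_le_mul_of_nonneg_left
      (Real.logb_le_logb_of_le (by norm_num) h
        (Finset.single_le_sum (fun b _ => hr a b) (Finset.mem_univ b))) h.le

lemma shEnt_prod_swap {A B : Type} [Fintype A] [Fintype B] (r : A → B → ℝ) :
    shEnt (fun ba : B × A => r ba.2 ba.1) = shEnt (fun ab : A × B => r ab.1 ab.2) := by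
  unfold shEnt
  rw [Fintype.sum_prod_type, Fintype.sum_prod_type, Finset.sum_comm]

lemma mi2_swap {A B : Type} [Fintype A] [Fintype B] (r : A → B → ℝ) :
    mi2 (fun b a => r a b) = mi2 r := by
  unfold mi2
  rw [shEnt_prod_swap r]
  ring

lemma mi2_le_snd {A B : Type} [Fintype A] [Fintype B] (r : A → B → ℝ)
    (hr : ∀ a b, 0 ≤ r a b) : mi2 r ≤ shEnt (fun b => ∑ a, r a b) := by
  have := shEnt_fst_le r hr
  unfold mi2
  linarith

lemma mi2_le_fst {A B : Type} [Fintype A] [Fintype B] (r : A → B → ℝ)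
    (hr : ∀ a b, 0 ≤ r a b) : mi2 r ≤ shEnt (fun a => ∑ b, r a b) := by
  rw [← mi2_swap]
  exact mi2_le_snd _ fun b a => hr a b

/-- If the first coordinate is a function of the second, the mutual information is the
entropy of the first coordinate. -/
lemma mi2_eq_fst {A B : Type} [Fintype A] [Fintype B] (r : A → B → ℝ) (g : B → A)
    (h : ∀ a b, a ≠ g b → r a b = 0) : mi2 r = shEnt (fun a => ∑ b, r a b) := by
  have hs (b : B) : ∑ a, r a b = r (g b) b := Fintype.sum_eq_single _ fun a ha => h a b ha
  have : shEnt (fun ab : A × B => r ab.1 ab.2) = shEnt (fun b => ∑ a, r a b) := by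
    unfold shEnt
    rw [Fintype.sum_prod_type_right]
    congr 1
    refine Finset.sum_congr rfl fun b _ => ?_
    simp only [hs]
    exact Fintype.sum_eq_single (g b) fun a ha => by simp [h a b ha]
  unfold mi2
  rw [this]
  ring

lemma mi2_eq_snd {A B : Type} [Fintype A] [Fintype B] (r : A → B → ℝ) (g : A → B)
    (h : ∀ a b, b ≠ g a → r a b = 0) : mi2 r = shEnt (fun b => ∑ a, r a b) := by
  rw [← mi2_swap]
  exact mi2_eq_fst _ g fun b a => h a b

section Channels

variable {Y X W : Type} [Fintype Y] [Fintype X] [Fintype W]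

lemma sum_jointYW_left (p : Y → X → ℝ) (q : X → W → ℝ) (w : W) :
    ∑ y, jointYW p q y w = margW p q w := by
  simp only [jointYW, margW, margX, Finset.sum_mul]
  exact Finset.sum_comm

lemma sum_jointYW_right (p : Y → X → ℝ) {q : X → W → ℝ} (hq : IsKernel q) (y : Y) :
    ∑ w, jointYW p q y w = margY p y := by
  simp only [jointYW, margY]
  rw [Finset.sum_comm]
  simp [← Finset.mul_sum, hq.2]

lemma jointYW_nonneg {p : Y → X → ℝ} (hp : ∀ y x, 0 ≤ p y x) {q : X → W → ℝ}
    (hq : IsKernel q) (y : Y) (w : W) : 0 ≤ jointYW p q y w :=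
  Finset.sum_nonneg fun x _ => mul_nonneg (hp y x) (hq.1 x w)

lemma miYW_le_shEnt_margW {p : Y → X → ℝ} (hp : ∀ y x, 0 ≤ p y x) {q : X → W → ℝ}
    (hq : IsKernel q) : miYW p q ≤ shEnt (margW p q) := by
  have := mi2_le_snd (jointYW p q) (jointYW_nonneg hp hq)
  simp only [sum_jointYW_left] at this
  exact this

lemma miYW_le_shEnt_margY {p : Y → X → ℝ} (hp : ∀ y x, 0 ≤ p y x) {q : X → W → ℝ}
    (hq : IsKernel q) : miYW p q ≤ shEnt (margY p) := by
  have := mi2_le_fst (jointYW p q) (jointYW_nonneg hp hq)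
  simp only [sum_jointYW_right p hq] at this
  exact this

open Classical in
/-- The deterministic channel given by a function. -/
def detKernel (h : X → W) (x : X) (w : W) : ℝ := if w = h x then 1 else 0

lemma isKernel_detKernel (h : X → W) : IsKernel (detKernel h) := by
  refine ⟨fun x w => ?_, fun x => ?_⟩
  · unfold detKernel
    split_ifs <;> norm_num
  · exact (Fintype.sum_eq_single (h x) fun w hw => if_neg hw).trans (if_pos rfl)

/-- A deterministic function of `Y = f(X)` has relevance equal to its entropy. -/
lemma miYW_detKernel_comp {p : Y → X → ℝ} {f : X → Y} (hp : ∀ y x, y ≠ f x → p y x = 0)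
    (e : Y → W) :
    miYW p (detKernel fun x => e (f x)) = shEnt (margW p (detKernel fun x => e (f x))) := by
  unfold miYW
  rw [mi2_eq_snd _ e]
  · simp only [sum_jointYW_left]
  · intro y w hw
    refine Finset.sum_eq_zero fun x _ => ?_
    by_cases hy : y = f x
    · subst hy
      simp [detKernel, hw]
    · simp [hp y x hy]

/-- A deterministic channel from whose output `Y = f(X)` can be recovered has relevance `H(Y)`. -/
lemma miYW_detKernel_of_leftInverse {p : Y → X → ℝ} {f : X → Y}
    (hp : ∀ y x, y ≠ f x → p y x = 0) (h : X → W) (g : W → Y) (hg : ∀ x, g (h x) = f x) :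
    miYW p (detKernel h) = shEnt (margY p) := by
  unfold miYW
  rw [mi2_eq_fst _ g]
  · simp only [sum_jointYW_right p (isKernel_detKernel h)]
  · intro y w hw
    refine Finset.sum_eq_zero fun x _ => ?_
    by_cases hy : w = h x
    · rw [hp y x (by rwa [← hg, ← hy]), zero_mul]
    · simp [detKernel, hy]

lemma shEnt_margW_const {p : Y → X → ℝ} (hp : ∑ x, margX p x = 1) (w₀ : W) :
    shEnt (margW p (detKernel fun _ : X => w₀)) = 0 := by
  unfold shEnt
  rw [neg_eq_zero]
  refine Finset.sum_eq_zero fun w _ => ?_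
  by_cases hw : w = w₀ <;> simp [margW, detKernel, hw, hp]

end Channels

section Bottleneck

variable {Y X : Type} [Fintype Y] [Fintype X]

lemma miYW_le_Ffun_one {p : Y → X → ℝ} (hp : ∀ y x, 0 ≤ p y x) {M : ℕ}
    {q : X → Fin M → ℝ} (hq : IsKernel q) {γ : ℝ} (hγ : shEnt (margW p q) ≤ γ) :
    miYW p q ≤ Ffun p M 1 γ := by
  refine le_csSup ⟨γ, ?_⟩ ⟨q, hq, by simpa [entOrd] using hγ, rfl⟩
  rintro v ⟨q, hq, hH, rfl⟩
  exact (miYW_le_shEnt_margW hp hq).trans (by simpa [entOrd] using hH)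

lemma Ffun_one_le {p : Y → X → ℝ} (hp : ∀ y x, 0 ≤ p y x) {M : ℕ} {γ : ℝ} (hγ : 0 ≤ γ)
    (hY : 0 ≤ shEnt (margY p)) : Ffun p M 1 γ ≤ min γ (shEnt (margY p)) := by
  refine Real.sSup_le ?_ (le_min hγ hY)
  rintro v ⟨q, hq, hH, rfl⟩
  exact le_min ((miYW_le_shEnt_margW hp hq).trans (by simpa [entOrd] using hH))
    (miYW_le_shEnt_margY hp hq)

end Bottleneck

/-- A function below `min γ H` that vanishes from below at `0` and reaches `H` from `H` on has
`min γ H` as its concave envelope. -/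
lemma env_eq_min {F : ℝ → ℝ} {H : ℝ} (hle : ∀ γ, 0 ≤ γ → F γ ≤ min γ H)
    (h₀ : 0 ≤ F 0) (hH : ∀ γ, H ≤ γ → H ≤ F γ) {γ : ℝ} (hγ : 0 ≤ γ) :
    env F γ = min γ H := by
  have hub : ∀ v ∈ {v | ∃ t γ₁ γ₂ : ℝ, 0 ≤ t ∧ t ≤ 1 ∧ 0 ≤ γ₁ ∧ 0 ≤ γ₂ ∧
      t * γ₁ + (1 - t) * γ₂ = γ ∧ v = t * F γ₁ + (1 - t) * F γ₂}, v ≤ min γ H := by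
    rintro v ⟨t, γ₁, γ₂, ht₀, ht₁, h₁, h₂, rfl, rfl⟩
    obtain ⟨h₁a, h₁b⟩ := le_min_iff.1 (hle γ₁ h₁)
    obtain ⟨h₂a, h₂b⟩ := le_min_iff.1 (hle γ₂ h₂)
    have ht : 0 ≤ 1 - t := by linarith
    refine le_min (by gcongr) ?_
    calc t * F γ₁ + (1 - t) * F γ₂ ≤ t * H + (1 - t) * H := by gcongr
      _ = H := by ring
  have hmem : ∃ v ∈ {v | ∃ t γ₁ γ₂ : ℝ, 0 ≤ t ∧ t ≤ 1 ∧ 0 ≤ γ₁ ∧ 0 ≤ γ₂ ∧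
      t * γ₁ + (1 - t) * γ₂ = γ ∧ v = t * F γ₁ + (1 - t) * F γ₂}, min γ H ≤ v := by
    rcases le_or_gt H γ with h | h
    · exact ⟨F γ, ⟨1, γ, γ, by norm_num, le_rfl, hγ, hγ, by ring, by ring⟩,
        (min_le_right _ _).trans (hH γ h)⟩
    · have hpos : 0 < H := hγ.trans_lt h
      have ht₀ : 0 ≤ γ / H := by positivity
      have ht₁ : γ / H ≤ 1 := (div_le_one hpos).2 h.le
      refine ⟨_, ⟨γ / H, H, 0, ht₀, ht₁, hpos.le, le_rfl, by field_simp; ring, rfl⟩, ?_⟩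
      calc min γ H ≤ γ / H * H + 0 := by
            rw [div_mul_cancel₀ _ hpos.ne', add_zero]
            exact min_le_left _ _
        _ ≤ γ / H * F H + (1 - γ / H) * F 0 :=
            add_le_add (mul_le_mul_of_nonneg_left (hH H le_rfl) ht₀)
              (mul_nonneg (by linarith) h₀)
  obtain ⟨v, hv, hvle⟩ := hmem
  exact le_antisymm (csSup_le ⟨v, hv⟩ hub) (hvle.trans (le_csSup ⟨_, hub⟩ hv))

/-- Example 1: if `Y = f(X)` and `M ≥ |𝒳|` then `I(Y;X) = H(Y)` and
`\bar I_{1,M}(γ) = Ω(γ) = min(γ, H(Y))` for all `γ ≥ 0`. -/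
theorem stmt14 {Y X : Type} [Fintype Y] [Fintype X] [DecidableEq Y]
    (pX : X → ℝ) (hpX : (∀ x, 0 ≤ pX x) ∧ ∑ x, pX x = 1)
    (f : X → Y) (p : Y → X → ℝ) (hpdef : ∀ y x, p y x = if y = f x then pX x else 0)
    (M : ℕ) (hM : Fintype.card X ≤ M) (γ : ℝ) (hγ : 0 ≤ γ) :
    miYX p = shEnt (margY p) ∧
    env (Ffun p M 1) γ = min γ (shEnt (margY p)) := by
  have hp : ∀ y x, 0 ≤ p y x := by
    intro y x
    rw [hpdef]
    split_ifs
    exacts [hpX.1 x, le_rfl]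
  have hf : ∀ y x, y ≠ f x → p y x = 0 := fun y x h => by rw [hpdef, if_neg h]
  refine ⟨mi2_eq_fst p f hf, ?_⟩
  have hmX : ∑ x, margX p x = 1 := by simp [margX, hpdef, hpX.2]
  have : Nonempty X := by
    by_contra h
    rw [not_nonempty_iff] at h
    simpa using hpX.2
  obtain ⟨ι⟩ : Nonempty (X ↪ Fin M) :=
    Function.Embedding.nonempty_of_card_le (by simpa using hM)
  let w₀ : Fin M := ι (Classical.arbitrary X)
  have hconst : miYW p (detKernel fun _ : X => w₀) = 0 :=
    (miYW_detKernel_comp hf fun _ => w₀).trans (shEnt_margW_const hmX w₀)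
  have hY : 0 ≤ shEnt (margY p) :=
    hconst ▸ miYW_le_shEnt_margY hp (isKernel_detKernel _)
  let e : Y → Fin M := fun y => ι (Function.invFun f y)
  have hrec : miYW p (detKernel fun x => e (f x)) = shEnt (margY p) := by
    refine miYW_detKernel_of_leftInverse hf _ (fun w => f (Function.invFun ι w)) fun x => ?_
    simp only [e, Function.leftInverse_invFun ι.injective _]
    exact Function.invFun_eq ⟨x, rfl⟩
  refine env_eq_min (fun γ hγ => Ffun_one_le hp hγ hY) ?_ (fun γ h => ?_) hγ
  · rw [← hconst]
    exact miYW_le_Ffun_one hp (isKernel_detKernel _) (by rw [shEnt_margW_const hmX, hconst])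
  · rw [← hrec]
    refine miYW_le_Ffun_one hp (isKernel_detKernel _) ?_
    rwa [← miYW_detKernel_comp hf, hrec]

end
end
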